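/- arXiv:2312.08316 — 2 statements merged into one kernel-verified Lean document; each statement's English description precedes it below -/
import Mathlib

section
/- Assume that S generates M as a group. The monoid of all monoid homomorphisms (S, +) → (K, ·) with the product * admits a zero element (an element z with z*x = x*z = z for all x) if and only if S ∩ (−S) = {0} and −e₁ ∉ S and −e₂ ∉ S. In that case the zero element is the map sending 0 to 1 and every nonzero u ∈ S to 0. -/
open Finset

/-- The monoid `S = σ∨ ∩ M` of lattice points of the dual cone: elements `u ∈ M` with
`⟨p_j, u⟩ ≥ 0` for all `j`. -/
def dualS {M : Type*} [AddCommGroup M] {m : ℕ} (p : Fin (m + 1) → (M →+ ℤ)) :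
    AddSubmonoid M where
  carrier := {u | ∀ j, 0 ≤ p j u}
  zero_mem' := fun j => by simp
  add_mem' := fun {u v} hu hv j => by
    rw [map_add]; exact add_nonneg (hu j) (hv j)

/-- A point of the affine toric variety `X_σ`: a monoid homomorphism `(S, +) → (K, ·)`. -/
def IsPoint {K M : Type*} [Field K] [AddCommGroup M] {m : ℕ}
    (p : Fin (m + 1) → (M →+ ℤ)) (x : dualS p → K) : Prop :=
  x 0 = 1 ∧ ∀ u v : dualS p, x (u + v) = x u * x v

open Classical in
/-- Extension of a function on `S` to all of `M` by zero. -/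
noncomputable def extend {K M : Type*} [Field K] [AddCommGroup M] {m : ℕ}
    (p : Fin (m + 1) → (M →+ ℤ)) (x : dualS p → K) : M → K :=
  fun v => if h : v ∈ dualS p then x ⟨v, h⟩ else 0

/-- `e` is a Demazure root corresponding to the distinguished ray spanned by `p 0`:
`⟨p 0, e⟩ = −1` and `⟨p j, e⟩ ≥ 0` for all other `j`. -/
def IsDemazureRoot {M : Type*} [AddCommGroup M] {m : ℕ}
    (p : Fin (m + 1) → (M →+ ℤ)) (e : M) : Prop :=
  p 0 e = -1 ∧ ∀ j, j ≠ 0 → 0 ≤ p j e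

/-- The product of two points:
`(x*y)(u) = Σ_{i+j=⟨p,u⟩} C(⟨p,u⟩,i) · x(u + i·e₂) · y(u + j·e₁)`. -/
noncomputable def prodPt {K M : Type*} [Field K] [AddCommGroup M] {m : ℕ}
    (p : Fin (m + 1) → (M →+ ℤ)) (e₁ e₂ : M) (x y : dualS p → K) : dualS p → K :=
  fun u => ∑ i ∈ Finset.range ((p 0 (u : M)).toNat + 1),
    ((p 0 (u : M)).toNat.choose i : K) *
      extend p x ((u : M) + i • e₂) *
      extend p y ((u : M) + ((p 0 (u : M)).toNat - i) • e₁)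

/-- The identity element `x_ρ` : `x_ρ(u) = 1` if `⟨p, u⟩ = 0` and `0` otherwise. -/
noncomputable def xrho {K M : Type*} [Field K] [AddCommGroup M] {m : ℕ}
    (p : Fin (m + 1) → (M →+ ℤ)) : dualS p → K :=
  fun u => if p 0 (u : M) = 0 then 1 else 0

open Classical in
/-- The candidate zero element: sends `0` to `1` and every nonzero `u ∈ S` to `0`. -/
noncomputable def zeroPt {K M : Type*} [Field K] [AddCommGroup M] {m : ℕ}
    (p : Fin (m + 1) → (M →+ ℤ)) : dualS p → K :=
  fun u => if (u : M) = 0 then 1 else 0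

section

variable {K M : Type*} [Field K] [AddCommGroup M] {m : ℕ} {p : Fin (m + 1) → (M →+ ℤ)}

lemma extend_of_mem (x : dualS p → K) {v : M} (h : v ∈ dualS p) :
    extend p x v = x ⟨v, h⟩ := dif_pos h

lemma extend_one_of_mem {v : M} (h : v ∈ dualS p) : extend p (fun _ => (1 : K)) v = 1 :=
  extend_of_mem _ h

lemma extend_zero {x : dualS p → K} (hx : IsPoint p x) : extend p x 0 = 1 :=
  (extend_of_mem x (zero_mem _)).trans hx.1

lemma extend_zeroPt_of_ne {v : M} (h : v ≠ 0) : extend p (zeroPt (K := K) p) v = 0 := by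
  unfold extend zeroPt
  split <;> simp_all

lemma isPoint_one : IsPoint p (fun _ => (1 : K)) :=
  ⟨rfl, fun _ _ => (mul_one 1).symm⟩

lemma isPoint_zeroPt (hS : ∀ u : M, u ∈ dualS p → -u ∈ dualS p → u = 0) :
    IsPoint p (zeroPt (K := K) p) := by
  refine ⟨by simp [zeroPt], fun u v => ?_⟩
  have key : (u : M) + v = 0 ↔ (u : M) = 0 ∧ (v : M) = 0 := by
    refine ⟨fun h => ?_, fun h => by simp [h.1, h.2]⟩
    have hu : (u : M) = 0 := hS u u.2 (by rw [neg_eq_of_add_eq_zero_right h]; exact v.2)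
    exact ⟨hu, by simpa [hu] using h⟩
  by_cases hu : (u : M) = 0 <;> by_cases hv : (v : M) = 0 <;> simp [zeroPt, key, hu, hv]

/-- The monoid `S` meets the half-line spanned by `-e` away from `0` only if `-e ∈ S`. -/
lemma add_nsmul_ne_zero {e u : M} (he : -e ∉ dualS p) (hu : u ∈ dualS p) (hu0 : u ≠ 0) (i : ℕ) :
    u + i • e ≠ 0 := by
  intro h
  obtain rfl | hi := i.eq_zero_or_pos
  · exact hu0 (by simpa using h)
  refine he fun j => ?_
  have hj : p j u + i * p j e = 0 := by simpa using congrArg (p j) h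
  have hpos : (0 : ℤ) < i := by exact_mod_cast hi
  have := hu j
  rw [map_neg]
  by_contra! hneg
  nlinarith

lemma prodPt_apply_of_eq_zero {e₁ e₂ : M} (x y : dualS p → K) {u : dualS p}
    (hu : p 0 (u : M) = 0) : prodPt p e₁ e₂ x y u = x u * y u := by
  simp [prodPt, hu, extend_of_mem]

lemma prodPt_apply_of_eq_one {e₁ e₂ : M} (x y : dualS p → K) {u : dualS p}
    (hu : p 0 (u : M) = 1) : prodPt p e₁ e₂ x y u =
      x u * extend p y (u + e₁) + extend p x (u + e₂) * y u := by
  simp [prodPt, hu, Finset.sum_range_succ, extend_of_mem]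

lemma zeroPt_prodPt {e₁ e₂ : M} (he₂ : -e₂ ∉ dualS p) {x : dualS p → K} (hx : IsPoint p x) :
    prodPt p e₁ e₂ (zeroPt p) x = zeroPt p := by
  funext u
  by_cases hu : (u : M) = 0
  · obtain rfl : u = 0 := Subtype.ext hu
    simp [prodPt_apply_of_eq_zero, hx.1]
  · simp [prodPt, extend_zeroPt_of_ne (add_nsmul_ne_zero he₂ u.2 hu _), zeroPt, hu]

lemma prodPt_zeroPt {e₁ e₂ : M} (he₁ : -e₁ ∉ dualS p) {x : dualS p → K} (hx : IsPoint p x) :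
    prodPt p e₁ e₂ x (zeroPt p) = zeroPt p := by
  funext u
  by_cases hu : (u : M) = 0
  · obtain rfl : u = 0 := Subtype.ext hu
    simp [prodPt_apply_of_eq_zero, hx.1]
  · simp [prodPt, extend_zeroPt_of_ne (add_nsmul_ne_zero he₁ u.2 hu _), zeroPt, hu]

lemma IsDemazureRoot.sub_mem {e e' : M} (he : IsDemazureRoot p e) (he' : IsDemazureRoot p e')
    (hneg : -e ∈ dualS p) : -e + e' ∈ dualS p := fun j => by
  rw [map_add]
  obtain rfl | hj := eq_or_ne j 0
  · simp [he.1, he'.1]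
  · exact add_nonneg (hneg j) (he'.2 j hj)

lemma neg_notMem_of_one_prodPt_eq {e₁ e₂ : M} (he₁ : IsDemazureRoot p e₁)
    (he₂ : IsDemazureRoot p e₂) {z : dualS p → K} (hz : IsPoint p z)
    (h : prodPt p e₁ e₂ (fun _ => 1) z = z) : -e₁ ∉ dualS p := fun hmem => by
  have := congrFun h ⟨-e₁, hmem⟩
  rw [prodPt_apply_of_eq_one _ _ (by simp [he₁.1]),
    extend_one_of_mem (he₁.sub_mem he₂ hmem)] at this
  simp [extend_zero hz] at this

lemma neg_notMem_of_prodPt_one_eq {e₁ e₂ : M} (he₁ : IsDemazureRoot p e₁)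
    (he₂ : IsDemazureRoot p e₂) {z : dualS p → K} (hz : IsPoint p z)
    (h : prodPt p e₁ e₂ z (fun _ => 1) = z) : -e₂ ∉ dualS p := fun hmem => by
  have := congrFun h ⟨-e₂, hmem⟩
  rw [prodPt_apply_of_eq_one _ _ (by simp [he₂.1]),
    extend_one_of_mem (he₂.sub_mem he₁ hmem)] at this
  simp [extend_zero hz] at this

lemma isPoint_two_zpow [CharZero K] (f : M →+ ℤ) :
    IsPoint p (fun u => (2 : K) ^ f (u : M)) :=
  ⟨by simp, fun u v => by simp [zpow_add₀]⟩

lemma two_zpow_eq_one_iff [CharZero K] {n : ℤ} : (2 : K) ^ n = 1 ↔ n = 0 := by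
  refine ⟨fun h => ?_, fun h => by simp [h]⟩
  have hQ : (2 : ℚ) ^ n = 1 := by exact_mod_cast (by push_cast; exact h : (((2 : ℚ) ^ n : ℚ) : K) = 1)
  exact (zpow_eq_one_iff_right₀ (by norm_num) (by norm_num)).1 hQ

/-- A left zero of the product can only exist if the only invertible element of `S` is `0`. -/
lemma eq_zero_of_prodPt_eq [CharZero K] [Module.Free ℤ M] {e₁ e₂ : M} {z : dualS p → K}
    (hz : IsPoint p z) (h : ∀ x : dualS p → K, IsPoint p x → prodPt p e₁ e₂ z x = z)
    {u : M} (hu : u ∈ dualS p) (hu' : -u ∈ dualS p) : u = 0 := by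
  let b := Module.Free.chooseBasis ℤ M
  refine b.ext_elem fun k => ?_
  have hp : p 0 u = 0 := le_antisymm (by simpa using hu' 0) (hu 0)
  have hzu : z ⟨u, hu⟩ ≠ 0 := by
    refine left_ne_zero_of_mul_eq_one (b := z ⟨-u, hu'⟩) ?_
    rw [← hz.2, ← hz.1]
    exact congrArg z (Subtype.ext (add_neg_cancel u))
  have hx := congrFun (h _ (isPoint_two_zpow (b.coord k).toAddMonoidHom)) ⟨u, hu⟩
  rw [prodPt_apply_of_eq_zero _ _ hp, mul_eq_left₀ hzu, two_zpow_eq_one_iff] at hx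
  simpa using hx

end

/-- Assume `S` generates `M` as a group.  The monoid of all monoid
homomorphisms `(S, +) → (K, ·)` with the product `*` admits a zero element iff
`S ∩ (−S) = {0}`, `−e₁ ∉ S` and `−e₂ ∉ S`; and in that case the zero element is the map
sending `0` to `1` and every nonzero `u ∈ S` to `0`. -/
theorem stmt_9 {K M : Type*} [Field K] [IsAlgClosed K] [CharZero K]
    [AddCommGroup M] [Module.Free ℤ M] [Module.Finite ℤ M] {m : ℕ}
    (p : Fin (m + 1) → (M →+ ℤ)) (e₁ e₂ : M)
    (he₁ : IsDemazureRoot p e₁) (he₂ : IsDemazureRoot p e₂)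
    (hgen : AddSubgroup.closure (dualS p : Set M) = ⊤) :
    ((∃ z : dualS p → K, IsPoint p z ∧ ∀ x : dualS p → K, IsPoint p x →
        prodPt p e₁ e₂ z x = z ∧ prodPt p e₁ e₂ x z = z) ↔
      ((∀ u : M, u ∈ dualS p → -u ∈ dualS p → u = 0) ∧
        -e₁ ∉ dualS p ∧ -e₂ ∉ dualS p)) ∧
    (((∀ u : M, u ∈ dualS p → -u ∈ dualS p → u = 0) ∧
        -e₁ ∉ dualS p ∧ -e₂ ∉ dualS p) →
      (IsPoint p (zeroPt (K := K) p) ∧ ∀ x : dualS p → K, IsPoint p x →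
        prodPt p e₁ e₂ (zeroPt p) x = zeroPt p ∧
        prodPt p e₁ e₂ x (zeroPt p) = zeroPt p)) := by
  have hzero : ((∀ u : M, u ∈ dualS p → -u ∈ dualS p → u = 0) ∧
        -e₁ ∉ dualS p ∧ -e₂ ∉ dualS p) →
      (IsPoint p (zeroPt (K := K) p) ∧ ∀ x : dualS p → K, IsPoint p x →
        prodPt p e₁ e₂ (zeroPt p) x = zeroPt p ∧
        prodPt p e₁ e₂ x (zeroPt p) = zeroPt p) := fun ⟨hS, h₁, h₂⟩ =>
    ⟨isPoint_zeroPt hS, fun x hx => ⟨zeroPt_prodPt h₂ hx, prodPt_zeroPt h₁ hx⟩⟩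
  refine ⟨⟨?_, fun h => ⟨_, hzero h⟩⟩, hzero⟩
  rintro ⟨z, hz, h⟩
  exact ⟨fun u hu hu' => eq_zero_of_prodPt_eq hz (fun x hx => (h x hx).1) hu hu',
    neg_notMem_of_one_prodPt_eq he₁ he₂ hz (h _ isPoint_one).2,
    neg_notMem_of_prodPt_one_eq he₁ he₂ hz (h _ isPoint_one).1⟩
end

section
/- Suppose p ∉ γ, e₁ ∈ γ^⊥, and e₂ ∈ γ^⊥. Then the orbit O_γ contains no idempotent: no monoid homomorphism x : (S, +) → (K, ·) with (x(u) ≠ 0 exactly when u ∈ γ^⊥, for u ∈ S) satisfies x*x = x. -/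
open Finset

/-- For a face `γ` of `σ` cut out by a supporting lattice vector `w` (i.e. `⟨p_j, w⟩ ≥ 0` for
all `j`, and `γ` is generated by those `p_j` with `⟨p_j, w⟩ = 0`), the lattice part of
`γ^⊥ = {u : ⟨v, u⟩ = 0 for all v ∈ γ}`. -/
def gPerp {M : Type*} [AddCommGroup M] {m : ℕ}
    (p : Fin (m + 1) → (M →+ ℤ)) (w : M) : Set M :=
  {u | ∀ j, p j w = 0 → p j u = 0}

/-- `x` lies in the torus orbit `O_γ`: for `u ∈ S`, `x(u) ≠ 0` exactly when `u ∈ γ^⊥`. -/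
def inOrbit {K M : Type*} [Field K] [AddCommGroup M] {m : ℕ}
    (p : Fin (m + 1) → (M →+ ℤ)) (w : M) (x : dualS p → K) : Prop :=
  ∀ u : dualS p, x u ≠ 0 ↔ (u : M) ∈ gPerp p w

section

variable {K M : Type*} [Field K] [AddCommGroup M] {m : ℕ} {p : Fin (m + 1) → (M →+ ℤ)}

lemma IsDemazureRoot.add_nsmul_mem {e : M} (he : IsDemazureRoot p e) {u : M} (hu : u ∈ dualS p)
    {j : ℕ} (hj : (j : ℤ) ≤ p 0 u) : u + j • e ∈ dualS p := by
  intro k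
  rw [map_add, map_nsmul, nsmul_eq_mul]
  by_cases hk : k = 0
  · subst hk
    rw [he.1]
    linarith
  · exact add_nonneg (hu k) (mul_nonneg (Int.natCast_nonneg j) (he.2 k hk))

lemma IsPoint.extend_add {x : dualS p → K} (hx : IsPoint p x) {u v : M} (hu : u ∈ dualS p)
    (hv : v ∈ dualS p) : extend p x (u + v) = extend p x u * extend p x v := by
  simp only [extend, hu, hv, add_mem hu hv, dif_pos]
  exact hx.2 ⟨u, hu⟩ ⟨v, hv⟩

lemma IsPoint.extend_add_nsmul {x : dualS p → K} (hx : IsPoint p x) {e : M}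
    (he : IsDemazureRoot p e) {w : M} (hw : w ∈ dualS p) (hwe : w + e ∈ dualS p)
    (hxw : extend p x w ≠ 0) {u : M} (hu : u ∈ dualS p) {j : ℕ} (hj : (j : ℤ) ≤ p 0 u) :
    extend p x (u + j • e) = extend p x u * (extend p x (w + e) / extend p x w) ^ j := by
  induction j with
  | zero => simp
  | succ j ih =>
    have hj' : (j : ℤ) ≤ p 0 u := by push_cast at hj; linarith
    have h₁ := hx.extend_add (he.add_nsmul_mem hu hj') hwe
    have h₂ := hx.extend_add (he.add_nsmul_mem hu hj) hw
    rw [show u + j • e + (w + e) = u + (j + 1) • e + w by rw [succ_nsmul]; abel, h₂, ih hj'] at h₁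
    rw [eq_div_of_mul_eq hxw h₁, pow_succ]
    ring

lemma IsPoint.prodPt_self {x : dualS p → K} (hx : IsPoint p x) {e₁ e₂ : M}
    (he₁ : IsDemazureRoot p e₁) (he₂ : IsDemazureRoot p e₂) {w : M} (hw : w ∈ dualS p)
    (hw₁ : w + e₁ ∈ dualS p) (hw₂ : w + e₂ ∈ dualS p) (hxw : extend p x w ≠ 0) (u : dualS p) :
    prodPt p e₁ e₂ x x u = extend p x u ^ 2 *
      (extend p x (w + e₂) / extend p x w + extend p x (w + e₁) / extend p x w) ^
        (p 0 (u : M)).toNat := by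
  have hd : ((p 0 (u : M)).toNat : ℤ) = p 0 (u : M) := Int.toNat_of_nonneg (u.2 0)
  rw [prodPt, add_pow, Finset.mul_sum]
  refine Finset.sum_congr rfl fun i hi => ?_
  have hi' : i ≤ (p 0 (u : M)).toNat := Nat.lt_succ_iff.mp (Finset.mem_range.mp hi)
  rw [hx.extend_add_nsmul he₂ hw hw₂ hxw u.2 (by omega),
    hx.extend_add_nsmul he₁ hw hw₁ hxw u.2 (by omega)]
  ring

end

/-- **Statement 11.** Suppose `p ∉ γ` (i.e. `⟨p, w⟩ ≠ 0`), `e₁ ∈ γ^⊥`, and `e₂ ∈ γ^⊥`.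
Then the orbit `O_γ` contains no idempotent. -/
theorem stmt_12 {K M : Type*} [Field K] [IsAlgClosed K] [CharZero K]
    [AddCommGroup M] [Module.Free ℤ M] [Module.Finite ℤ M] {m : ℕ}
    (p : Fin (m + 1) → (M →+ ℤ)) (e₁ e₂ : M)
    (he₁ : IsDemazureRoot p e₁) (he₂ : IsDemazureRoot p e₂)
    (w : M) (hw : ∀ j, 0 ≤ p j w) (hpγ : p 0 w ≠ 0)
    (h₁ : e₁ ∈ gPerp p w) (h₂ : e₂ ∈ gPerp p w) :
    ¬ ∃ x : dualS p → K, IsPoint p x ∧ inOrbit p w x ∧ prodPt p e₁ e₂ x x = x := by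
  rintro ⟨x, hx, horb, hid⟩
  have hpos : 0 < p 0 w := lt_of_le_of_ne (hw 0) hpγ.symm
  have hwS : w ∈ dualS p := hw
  have hmem : ∀ {e : M}, IsDemazureRoot p e → w + e ∈ dualS p := fun he => by
    simpa using he.add_nsmul_mem hwS (j := 1) (by push_cast; linarith)
  have hne : ∀ {u : M}, u ∈ dualS p → u ∈ gPerp p w → extend p x u ≠ 0 := fun {u} hu hγ => by
    rw [extend, dif_pos hu]
    exact (horb ⟨u, hu⟩).2 hγ
  have hperp : ∀ {e : M}, e ∈ gPerp p w → w + e ∈ gPerp p w := fun h j hj => by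
    rw [map_add, hj, h j hj, add_zero]
  have hxw : extend p x w ≠ 0 := hne hwS fun _ h => h
  have key : ∀ {u : M}, u ∈ dualS p → u ∈ gPerp p w →
      extend p x u * (extend p x (w + e₂) / extend p x w + extend p x (w + e₁) / extend p x w) ^
        (p 0 u).toNat = 1 := fun {u} hu hγ => by
    have h := hx.prodPt_self he₁ he₂ hwS (hmem he₁) (hmem he₂) hxw ⟨u, hu⟩
    rw [hid, show x ⟨u, hu⟩ = extend p x u by rw [extend, dif_pos hu]] at h
    refine mul_left_cancel₀ (hne hu hγ) ?_
    rw [mul_one, ← mul_assoc, ← sq]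
    exact h.symm
  have k₀ := key hwS fun _ h => h
  have k₁ := key (hmem he₁) (hperp h₁)
  have k₂ := key (hmem he₂) (hperp h₂)
  obtain ⟨n, hn⟩ : ∃ n : ℕ, p 0 w = n + 1 := ⟨(p 0 w - 1).toNat, by omega⟩
  rw [hn, show ((n : ℤ) + 1).toNat = n + 1 by omega, pow_succ] at k₀
  rw [map_add, he₁.1, hn, show ((n : ℤ) + 1 + -1).toNat = n by omega] at k₁
  rw [map_add, he₂.1, hn, show ((n : ℤ) + 1 + -1).toNat = n by omega] at k₂
  have hsum : extend p x w *
      (extend p x (w + e₂) / extend p x w + extend p x (w + e₁) / extend p x w) =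
        extend p x (w + e₂) + extend p x (w + e₁) := by
    field_simp
  have : (1 : K) = 1 + 1 := by
    rw [mul_comm (_ ^ n), ← mul_assoc, hsum, add_mul, k₁, k₂] at k₀
    exact k₀.symm
  simp at this
end
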